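/- Let K_{ab} be a smooth symmetric (0,2)-tensor field on U, and suppose that for every open interval I ⊆ ℝ and every twice-differentiable curve x : I → U satisfying the geodesic equation ẍ^a + Γ^a_{bc}(x)ẋ^bẋ^c = 0, the quantity C(τ) := K_{ab}(x(τ))ẋ^a(τ)ẋ^b(τ) is constant on I. Then K is a Killing tensor: ∇_aK_{bc} + ∇_bK_{ca} + ∇_cK_{ab} = 0 at every point of U. -/

import Mathlib

/-!
STATEMENT 14: If `K_{ab}ẋ^aẋ^b` is constant along every geodesic, then `K` is
a Killing tensor: `∇_aK_{bc} + ∇_bK_{ca} + ∇_cK_{ab} = 0` on `U`.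
-/

noncomputable section

abbrev Pt : Type := Fin 4 → ℝ

/-- Partial derivative of a scalar field in the `c`-th coordinate direction. -/
def pd (f : Pt → ℝ) (c : Fin 4) (p : Pt) : ℝ := fderiv ℝ f p (Pi.single c 1)

/-- Covariant derivative `∇_c K_{ab}` of a (0,2)-tensor field. -/
def cov2 (Γ : Fin 4 → Fin 4 → Fin 4 → Pt → ℝ) (K : Fin 4 → Fin 4 → Pt → ℝ)
    (c a b : Fin 4) (p : Pt) : ℝ :=
  pd (K a b) c p - ∑ m, Γ m c a p * K m b p - ∑ m, Γ m c b p * K a m p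

/-- The vector field on `Pt × Pt` whose integral curves are the pairs (geodesic, velocity). -/
def geodesicSpray (Γ : Fin 4 → Fin 4 → Fin 4 → Pt → ℝ) (z : Pt × Pt) : Pt × Pt :=
  (z.2, fun a => -∑ b, ∑ c, Γ a b c z.1 * z.2 b * z.2 c)

lemma contDiffAt_geodesicSpray {Γ : Fin 4 → Fin 4 → Fin 4 → Pt → ℝ} {z : Pt × Pt}
    (hΓ : ∀ m a b, ContDiffAt ℝ 1 (Γ m a b) z.1) : ContDiffAt ℝ 1 (geodesicSpray Γ) z := by
  have hv (a : Fin 4) : ContDiffAt ℝ 1 (fun w : Pt × Pt => w.2 a) z := by fun_prop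
  refine contDiffAt_snd.prodMk (contDiffAt_pi.2 fun a => ContDiffAt.neg ?_)
  refine ContDiffAt.sum fun b _ => ContDiffAt.sum fun c _ => ?_
  exact (((hΓ a b c).comp z contDiffAt_fst).mul (hv b)).mul (hv c)

/-- Local existence of geodesics with prescribed initial position and velocity. -/
lemma exists_geodesic {U : Set Pt} (hU : IsOpen U) {Γ : Fin 4 → Fin 4 → Fin 4 → Pt → ℝ}
    (hΓ : ∀ m a b, ContDiffOn ℝ 1 (Γ m a b) U) {p : Pt} (hp : p ∈ U) (v : Pt) :
    ∃ ε > (0 : ℝ), ∃ x y : ℝ → Pt, x 0 = p ∧ y 0 = v ∧ ∀ t ∈ Set.Ioo (-ε) ε,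
      x t ∈ U ∧ HasDerivAt x (y t) t ∧
        HasDerivAt y (fun a => -∑ b, ∑ c, Γ a b c (x t) * y t b * y t c) t := by
  obtain ⟨γ, hγ0, ε, hε, hγ⟩ :=
    (contDiffAt_geodesicSpray (Γ := Γ) (z := (p, v)) fun m a b =>
      (hΓ m a b).contDiffAt (hU.mem_nhds hp)
      ).exists_forall_mem_closedBall_exists_eq_forall_mem_Ioo_hasDerivAt₀ 0
  rw [zero_sub, zero_add] at hγ
  have hcont : ContinuousAt (fun t => (γ t).1) 0 :=
    (hγ 0 ⟨by linarith, hε⟩).continuousAt.fst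
  have hmem : ∀ᶠ t in nhds 0, (γ t).1 ∈ U :=
    hcont.eventually (hU.mem_nhds (by simpa [hγ0] using hp))
  obtain ⟨δ, hδ, hball⟩ := Metric.eventually_nhds_iff.1 hmem
  refine ⟨min ε δ, lt_min hε hδ, fun t => (γ t).1, fun t => (γ t).2, by simp [hγ0],
    by simp [hγ0], fun t ht => ?_⟩
  have htε : t ∈ Set.Ioo (-ε) ε :=
    ⟨by linarith [ht.1, min_le_left ε δ], by linarith [ht.2, min_le_left ε δ]⟩
  have htδ : |t| < δ :=
    abs_lt.2 ⟨by linarith [ht.1, min_le_right ε δ], by linarith [ht.2, min_le_right ε δ]⟩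
  exact ⟨hball (by simpa using htδ), (hγ t htε).fst, (hγ t htε).snd⟩

/-- Polarization: the symmetrization of the coefficients of a vanishing cubic form is zero. -/
lemma sum_perm_eq_zero_of_cubic_form_eq_zero {ι : Type*} [Fintype ι] [DecidableEq ι]
    (T : ι → ι → ι → ℝ) (hT : ∀ v : ι → ℝ, ∑ a, ∑ b, ∑ c, T a b c * v a * v b * v c = 0)
    (a b c : ι) :
    T a b c + T a c b + T b a c + T b c a + T c a b + T c b a = 0 := by
  let F (x y z : ι → ℝ) : ℝ := ∑ a, ∑ b, ∑ c, T a b c * x a * y b * z c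
  have hF (x : ι → ℝ) : F x x x = 0 := hT x
  have add₁ (x x' y z : ι → ℝ) : F (x + x') y z = F x y z + F x' y z := by
    simp only [F, Pi.add_apply, mul_add, add_mul, Finset.sum_add_distrib]
  have add₂ (x y y' z : ι → ℝ) : F x (y + y') z = F x y z + F x y' z := by
    simp only [F, Pi.add_apply, mul_add, add_mul, Finset.sum_add_distrib]
  have add₃ (x y z z' : ι → ℝ) : F x y (z + z') = F x y z + F x y z' := by
    simp only [F, Pi.add_apply, mul_add, Finset.sum_add_distrib]
  have single (i j k : ι) : F (Pi.single i 1) (Pi.single j 1) (Pi.single k 1) = T i j k := by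
    simp [F, Pi.single_apply]
  have polar (x y z : ι → ℝ) :
      F x y z + F x z y + F y x z + F y z x + F z x y + F z y x = 0 := by
    have hxyz := hF (x + y + z)
    have hxy := hF (x + y)
    have hxz := hF (x + z)
    have hyz := hF (y + z)
    simp only [add₁, add₂, add₃] at hxyz hxy hxz hyz
    linarith [hF x, hF y, hF z]
  simpa only [single] using polar (Pi.single a 1) (Pi.single b 1) (Pi.single c 1)

lemma fderiv_eq_sum_pd (f : Pt → ℝ) (p v : Pt) : fderiv ℝ f p v = ∑ c, pd f c p * v c := by
  conv_lhs => rw [pi_eq_sum_univ' v]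
  simp [pd, mul_comm]

/-- The derivative of `K_{ab} v^a v^b` along a geodesic with velocity `v` is
`(∇_c K_{ab}) v^c v^a v^b`. -/
lemma sum_cov2_mul_eq (Γ : Fin 4 → Fin 4 → Fin 4 → Pt → ℝ) (K : Fin 4 → Fin 4 → Pt → ℝ)
    (p v : Pt) :
    ∑ c, ∑ a, ∑ b, cov2 Γ K c a b p * v c * v a * v b =
      ∑ a, ∑ b, ((fderiv ℝ (K a b) p v * v a
        + K a b p * -∑ c, ∑ d, Γ a c d p * v c * v d) * v b
        + K a b p * v a * -∑ c, ∑ d, Γ b c d p * v c * v d) := by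
  have hd : ∑ c, ∑ a, ∑ b, pd (K a b) c p * v c * v a * v b =
      ∑ a, ∑ b, fderiv ℝ (K a b) p v * v a * v b := by
    simp only [fderiv_eq_sum_pd, Finset.sum_mul]
    rw [Finset.sum_comm]
    exact Finset.sum_congr rfl fun a _ => Finset.sum_comm
  have h₁ : ∑ c, ∑ a, ∑ b, (∑ m, Γ m c a p * K m b p) * v c * v a * v b =
      ∑ a, ∑ b, K a b p * (∑ c, ∑ d, Γ a c d p * v c * v d) * v b := by
    simp only [Finset.sum_mul, Finset.mul_sum]
    rw [Finset.sum_congr rfl fun c _ => Finset.sum_congr rfl fun a _ => Finset.sum_comm,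
      Finset.sum_comm_cycle]
    refine Finset.sum_congr rfl fun m _ => ?_
    rw [Finset.sum_comm_cycle]
    refine Finset.sum_congr rfl fun b _ => Finset.sum_congr rfl fun c _ =>
      Finset.sum_congr rfl fun a _ => ?_
    ring
  have h₂ : ∑ c, ∑ a, ∑ b, (∑ m, Γ m c b p * K a m p) * v c * v a * v b =
      ∑ a, ∑ b, K a b p * v a * (∑ c, ∑ d, Γ b c d p * v c * v d) := by
    simp only [Finset.sum_mul, Finset.mul_sum]
    rw [Finset.sum_comm]
    refine Finset.sum_congr rfl fun a _ => ?_
    rw [Finset.sum_comm_cycle]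
    refine Finset.sum_congr rfl fun m _ => Finset.sum_congr rfl fun c _ =>
      Finset.sum_congr rfl fun b _ => ?_
    ring
  simp only [cov2, sub_mul, add_mul, mul_neg, neg_mul, Finset.sum_sub_distrib,
    Finset.sum_add_distrib, Finset.sum_neg_distrib, hd, h₁, h₂]
  ring

lemma cov2_symm {U : Set Pt} (hU : IsOpen U) (Γ : Fin 4 → Fin 4 → Fin 4 → Pt → ℝ)
    {K : Fin 4 → Fin 4 → Pt → ℝ} (hK : ∀ a b, ∀ p ∈ U, K a b p = K b a p) {p : Pt} (hp : p ∈ U)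
    (c a b : Fin 4) : cov2 Γ K c a b p = cov2 Γ K c b a p := by
  have hpd : pd (K a b) c p = pd (K b a) c p := by
    have h : K a b =ᶠ[nhds p] K b a := by
      filter_upwards [hU.mem_nhds hp] with q hq using hK a b q hq
    rw [pd, pd, h.fderiv_eq]
  simp only [cov2, hpd, hK a _ p hp, hK _ b p hp]
  ring

theorem constant_along_geodesics_implies_killing_tensor
    (U : Set Pt) (hU : IsOpen U)
    (Γ : Fin 4 → Fin 4 → Fin 4 → Pt → ℝ)
    (hΓsmooth : ∀ m a b, ContDiffOn ℝ (⊤ : ℕ∞) (Γ m a b) U)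
    (hΓsymm : ∀ m a b, ∀ p ∈ U, Γ m a b p = Γ m b a p)
    (K : Fin 4 → Fin 4 → Pt → ℝ)
    (hKsmooth : ∀ a b, ContDiffOn ℝ (⊤ : ℕ∞) (K a b) U)
    (hKsymm : ∀ a b, ∀ p ∈ U, K a b p = K b a p)
    (hconst : ∀ (I : Set ℝ), IsOpen I → Set.OrdConnected I →
      ∀ (x : ℝ → Pt), (∀ τ ∈ I, x τ ∈ U) →
      (∀ a, ∀ τ ∈ I, DifferentiableAt ℝ (fun t => x t a) τ) →
      (∀ a, ∀ τ ∈ I, DifferentiableAt ℝ (deriv fun t => x t a) τ) →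
      (∀ τ ∈ I, ∀ a,
        deriv (deriv fun t => x t a) τ
          + (∑ b, ∑ c, Γ a b c (x τ) * deriv (fun t => x t b) τ * deriv (fun t => x t c) τ)
          = 0) →
      ∀ τ₁ ∈ I, ∀ τ₂ ∈ I,
        (∑ a, ∑ b, K a b (x τ₁) * deriv (fun t => x t a) τ₁ * deriv (fun t => x t b) τ₁)
          = ∑ a, ∑ b, K a b (x τ₂) * deriv (fun t => x t a) τ₂ * deriv (fun t => x t b) τ₂) :
    ∀ p ∈ U, ∀ a b c,
      cov2 Γ K a b c p + cov2 Γ K b c a p + cov2 Γ K c a b p = 0 := by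
  intro p hp a b c
  have hcubic (v : Pt) : ∑ c, ∑ a, ∑ b, cov2 Γ K c a b p * v c * v a * v b = 0 := by
    obtain ⟨ε, hε, x, y, hx0, hy0, h⟩ :=
      exists_geodesic hU (fun m a b => (hΓsmooth m a b).of_le (by simp)) hp v
    have h0 : (0 : ℝ) ∈ Set.Ioo (-ε) ε := ⟨by linarith, hε⟩
    have hx (a) : ∀ t ∈ Set.Ioo (-ε) ε, HasDerivAt (fun s => x s a) (y t a) t :=
      fun t ht => hasDerivAt_pi.1 (h t ht).2.1 a
    have hy (a) := fun t ht => hasDerivAt_pi.1 (h t ht).2.2 a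
    have hdx (a) : ∀ t ∈ Set.Ioo (-ε) ε, deriv (fun s => x s a) t = y t a :=
      fun t ht => (hx a t ht).deriv
    have hddx (a) (t) (ht : t ∈ Set.Ioo (-ε) ε) :=
      (hy a t ht).congr_of_eventuallyEq <|
        Filter.eventually_of_mem (isOpen_Ioo.mem_nhds ht) (hdx a)
    have hC := hconst (Set.Ioo (-ε) ε) isOpen_Ioo Set.ordConnected_Ioo x (fun t ht => (h t ht).1)
      (fun a t ht => (hx a t ht).differentiableAt) (fun a t ht => (hddx a t ht).differentiableAt)
      (fun t ht a => by simp only [(hddx a t ht).deriv, hdx _ t ht, neg_add_cancel])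
    have hK (a b) : HasDerivAt (fun t => K a b (x t)) (fderiv ℝ (K a b) (x 0) (y 0)) 0 :=
      (((hKsmooth a b).contDiffAt (hU.mem_nhds (h 0 h0).1)).differentiableAt
        (by simp)).hasFDerivAt.comp_hasDerivAt 0 (h 0 h0).2.1
    have hderiv : HasDerivAt (fun t => ∑ a, ∑ b, K a b (x t) * y t a * y t b) _ 0 :=
      HasDerivAt.fun_sum fun a _ => HasDerivAt.fun_sum fun b _ =>
        ((hK a b).mul (hy a 0 h0)).mul (hy b 0 h0)
    have hzero : HasDerivAt (fun t => ∑ a, ∑ b, K a b (x t) * y t a * y t b) 0 0 := by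
      refine (hasDerivAt_const 0 (∑ a, ∑ b, K a b (x 0) * y 0 a * y 0 b)).congr_of_eventuallyEq ?_
      filter_upwards [isOpen_Ioo.mem_nhds h0] with t ht
      simpa only [hdx _ t ht, hdx _ 0 h0] using hC t ht 0 h0
    rw [sum_cov2_mul_eq, ← hx0, ← hy0]
    exact hderiv.unique hzero
  have hsymm := cov2_symm hU Γ hKsymm hp
  have hsum := sum_perm_eq_zero_of_cubic_form_eq_zero (fun a b c => cov2 Γ K a b c p) hcubic a b c
  linarith [hsymm a b c, hsymm b c a, hsymm c a b]
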